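/- Let V be a finite-dimensional complex vector space with a nondegenerate symmetric bilinear form Q, let 0 = V_{t+1} ⊆ V_t ⊆ ⋯ ⊆ V_1 = V be a reverse isotropic flag (i.e. V_i = (V_{t+2-i})^⊥ for all 1 ≤ i ≤ t+1), and let β̃_1 > β̃_2 > ⋯ > β̃_t be real weights with β̃_i + β̃_{t+1-i} = 0; set β̃_0 := 0. For a subspace S ⊆ V define P(S) := Σ_{i=1}^{t} (β̃_i − β̃_{i-1})·dim(S ∩ V_i). Then for every isotropic subspace W ⊆ V one has P(W) = P(W^⊥). (This is the parabolic-weight part of the identity pardeg(V') = pardeg((V')^⊥) of Lemma 4.1.) -/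

import Mathlib

open Module

theorem LinearMap.BilinForm.orthogonal_sup_eq_inf {K V : Type*} [Field K] [AddCommGroup V]
    [Module K V] (Q : LinearMap.BilinForm K V) (W U : Submodule K V) :
    Q.orthogonal (W ⊔ U) = Q.orthogonal W ⊓ Q.orthogonal U := by
  apply le_antisymm
  · exact le_inf (LinearMap.BilinForm.orthogonal_le le_sup_left)
      (LinearMap.BilinForm.orthogonal_le le_sup_right)
  · rintro x ⟨hxW, hxU⟩ y hy
    obtain ⟨w, hw, u, hu, rfl⟩ := Submodule.mem_sup.1 hy
    have h₁ : Q w x = 0 := hxW w hw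
    have h₂ : Q u x = 0 := hxU u hu
    simp [h₁, h₂]

theorem LinearMap.BilinForm.finrank_orthogonal_inf_orthogonal {K V : Type*} [Field K]
    [AddCommGroup V] [Module K V] [FiniteDimensional K V] (Q : LinearMap.BilinForm K V)
    (hQ : Q.Nondegenerate) (W U : Submodule K V) :
    finrank K ↥(Q.orthogonal W ⊓ Q.orthogonal U) + finrank K W + finrank K U =
      finrank K V + finrank K ↥(W ⊓ U) := by
  rw [← Q.orthogonal_sup_eq_inf, LinearMap.BilinForm.finrank_orthogonal hQ]
  have h₁ := Submodule.finrank_sup_add_finrank_inf_eq W U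
  have h₂ := Submodule.finrank_le (W ⊔ U)
  omega

/-- If `β` is antisymmetric under `i ↦ t + 1 - i` and `D i + D (t + 2 - i) = D 1` for
`2 ≤ i ≤ t`, then the sum of `D` weighted by the increments of `β` vanishes. -/
theorem sum_increments_mul_eq_zero (t : ℕ) (ht : 1 ≤ t) (β D : ℕ → ℝ) (hβ0 : β 0 = 0)
    (hβ : ∀ i, 1 ≤ i → i ≤ t → β i + β (t + 1 - i) = 0)
    (hD : ∀ i, 2 ≤ i → i ≤ t → D i + D (t + 2 - i) = D 1) :
    ∑ i ∈ Finset.Icc 1 t, (β i - β (i - 1)) * D i = 0 := by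
  have hsplit : ∑ i ∈ Finset.Icc 1 t, (β i - β (i - 1)) * D i =
      β 1 * D 1 + ∑ i ∈ Finset.Icc 2 t, (β i - β (i - 1)) * D i := by
    rw [← Finset.insert_Icc_add_one_left_eq_Icc ht, Finset.sum_insert (by simp)]
    simp [hβ0]
  have hrefl : ∑ i ∈ Finset.Icc 2 t, (β i - β (i - 1)) * D i =
      ∑ i ∈ Finset.Icc 2 t, (β i - β (i - 1)) * D (t + 2 - i) := by
    refine Finset.sum_bij' (fun i _ => t + 2 - i) (fun i _ => t + 2 - i) ?_ ?_ ?_ ?_ ?_ <;>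
      intro i hi <;> rw [Finset.mem_Icc] at hi
    · simp only [Finset.mem_Icc]; omega
    · simp only [Finset.mem_Icc]; omega
    · omega
    · omega
    · have h₁ := hβ i (by omega) hi.2
      have h₂ := hβ (i - 1) (by omega) (by omega)
      rw [show t + 1 - (i - 1) = t + 2 - i by omega] at h₂
      rw [show t + 2 - i - 1 = t + 1 - i by omega, show t + 2 - (t + 2 - i) = i by omega]
      congr 1
      linarith
  have htel : ∑ i ∈ Finset.Icc 2 t, (β i - β (i - 1)) = β t - β 1 := by
    clear hsplit hrefl hD hβ
    induction t, ht using Nat.le_induction with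
    | base => simp
    | succ n hn ih =>
      rw [Finset.sum_Icc_succ_top (by omega), ih, Nat.add_sub_cancel]
      ring
  have hdouble : 2 * ∑ i ∈ Finset.Icc 2 t, (β i - β (i - 1)) * D i = (β t - β 1) * D 1 := by
    rw [two_mul]
    nth_rewrite 2 [hrefl]
    rw [← Finset.sum_add_distrib, ← htel, Finset.sum_mul]
    refine Finset.sum_congr rfl fun i hi => ?_
    rw [Finset.mem_Icc] at hi
    rw [← mul_add, hD i hi.1 hi.2]
  have hend := hβ 1 le_rfl ht
  rw [Nat.add_sub_cancel] at hend
  rw [hsplit]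
  linear_combination hdouble / 2 + D 1 / 2 * hend

/-- The parabolic-weight part of the parabolic degree of an isotropic
subspace `W` equals that of its orthogonal complement `W^⊥`, with respect to a reverse
isotropic flag `0 = V_{t+1} ⊆ V_t ⊆ ⋯ ⊆ V_1 = V` with weights `β̃_1 > ⋯ > β̃_t`,
`β̃_i + β̃_{t+1-i} = 0`, `β̃_0 = 0`. (Lemma 4.1.) -/
theorem parabolic_part_eq_of_isotropic
    (V : Type*) [AddCommGroup V] [Module ℂ V] [FiniteDimensional ℂ V]
    (Q : LinearMap.BilinForm ℂ V) (hQsymm : Q.IsSymm) (hQnd : Q.Nondegenerate)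
    (t : ℕ) (ht : 1 ≤ t)
    (F : ℕ → Submodule ℂ V)
    (hbot : F (t + 1) = ⊥) (htop : F 1 = ⊤)
    (hchain : ∀ i, 1 ≤ i → i ≤ t → F (i + 1) ≤ F i)
    (hflag : ∀ i, 1 ≤ i → i ≤ t + 1 → F i = Q.orthogonal (F (t + 2 - i)))
    (β : ℕ → ℝ) (hβ0 : β 0 = 0)
    (hβstrict : ∀ i j, 1 ≤ i → i < j → j ≤ t → β j < β i)
    (hβsymm : ∀ i, 1 ≤ i → i ≤ t → β i + β (t + 1 - i) = 0)
    (P : Submodule ℂ V → ℝ)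
    (hP : ∀ S : Submodule ℂ V,
      P S = ∑ i ∈ Finset.Icc 1 t, (β i - β (i - 1)) * (finrank ℂ ↥(S ⊓ F i) : ℝ))
    (W : Submodule ℂ V) (hW : ∀ x ∈ W, ∀ y ∈ W, Q x y = 0) :
    P W = P (Q.orthogonal W) := by
  have hinf (i : ℕ) (h₁ : 1 ≤ i) (h₂ : i ≤ t + 1) :
      (finrank ℂ ↥(Q.orthogonal W ⊓ F i) : ℝ) + finrank ℂ W + finrank ℂ (F (t + 2 - i)) =
        finrank ℂ V + finrank ℂ ↥(W ⊓ F (t + 2 - i)) := by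
    rw [hflag i h₁ h₂]
    exact_mod_cast Q.finrank_orthogonal_inf_orthogonal hQnd W (F (t + 2 - i))
  have hdim (i : ℕ) (h₁ : 1 ≤ i) (h₂ : i ≤ t + 1) :
      (finrank ℂ (F i) : ℝ) + finrank ℂ (F (t + 2 - i)) = finrank ℂ V := by
    rw [hflag i h₁ h₂, LinearMap.BilinForm.finrank_orthogonal hQnd,
      Nat.cast_sub (Submodule.finrank_le _), sub_add_cancel]
  rw [← sub_eq_zero, ← neg_eq_zero, neg_sub, hP, hP, ← Finset.sum_sub_distrib]
  simp_rw [← mul_sub]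
  refine sum_increments_mul_eq_zero t ht β
    (fun i => (finrank ℂ ↥(Q.orthogonal W ⊓ F i) : ℝ) - finrank ℂ ↥(W ⊓ F i)) hβ0 hβsymm ?_
  intro i h₁ h₂
  have e₁ := hinf i (by omega) (by omega)
  have e₂ := hinf (t + 2 - i) (by omega) (by omega)
  have e₃ := hdim i (by omega) (by omega)
  have e₄ := hinf 1 le_rfl (by omega)
  rw [show t + 2 - (t + 2 - i) = i by omega] at e₂
  rw [show t + 2 - 1 = t + 1 by omega, hbot, htop, inf_top_eq, inf_bot_eq, finrank_bot] at e₄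
  rw [htop, inf_top_eq, inf_top_eq]
  push_cast at e₄
  linarith
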